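/- Let n ≥ 2 and let M be a symmetric (n+1)×(n+1) matrix over a commutative ring R. Assume that the quotient ring R/(I_n) is an integral domain and that I_{n−1} lies in the ideal of R generated by I_n. Then for every i with 0 ≤ i ≤ n−2, the minor I_n(i;n−1) lies in the ideal of R generated by I_n. -/

import Mathlib

open Matrix

/-- The strictly monotone map `Fin (m-1) → Fin m` whose image avoids exactly the value `i`. -/
def skipAt {m : ℕ} (i : Fin m) (x : Fin (m-1)) : Fin m :=
  if (x : ℕ) < (i : ℕ) then ⟨(x : ℕ), by have := x.isLt; omega⟩
  else ⟨(x : ℕ) + 1, by have := x.isLt; omega⟩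

/-- The top-left `n × n` block `A` of an `(n+1) × (n+1)` matrix `M`;
its determinant is `I_n`. -/
def topSq {R : Type*} [CommRing R] {n : ℕ} (M : Matrix (Fin (n+1)) (Fin (n+1)) R) :
    Matrix (Fin n) (Fin n) R :=
  M.submatrix Fin.castSucc Fin.castSucc

/-- The border entries `a_i := M_{i,n}` for `0 ≤ i ≤ n-1`. -/
def borderCoeff {R : Type*} [CommRing R] {n : ℕ} (M : Matrix (Fin (n+1)) (Fin (n+1)) R)
    (i : Fin n) : R :=
  M i.castSucc (Fin.last n)

/-- `I_{n-1}`: the determinant of the top-left `(n-1) × (n-1)` block of `M`. -/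
def Iprev {R : Type*} [CommRing R] {n : ℕ} (M : Matrix (Fin (n+1)) (Fin (n+1)) R) : R :=
  (M.submatrix (fun x : Fin (n-1) => (⟨(x : ℕ), by have := x.isLt; omega⟩ : Fin (n+1)))
     (fun x : Fin (n-1) => (⟨(x : ℕ), by have := x.isLt; omega⟩ : Fin (n+1)))).det

/-- The inclusion `Fin (n-1) → Fin n`. -/
def finCastPred {n : ℕ} (i : Fin (n-1)) : Fin n := ⟨(i : ℕ), by have := i.isLt; omega⟩

/-- `G_n := Σ_{0 ≤ i,j ≤ n-1} (-1)^{i+j} a_i a_j I_n(i;j)`, where `I_n(i;j)` is the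
determinant of the top-left `n × n` block with row `i` and column `j` deleted. -/
def Gpoly {R : Type*} [CommRing R] {n : ℕ} (M : Matrix (Fin (n+1)) (Fin (n+1)) R) : R :=
  ∑ i : Fin n, ∑ j : Fin n, (-1 : R) ^ ((i : ℕ) + (j : ℕ))
    * borderCoeff M i * borderCoeff M j
    * ((topSq M).submatrix (skipAt i) (skipAt j)).det

/-- `Li_n := a_{n-1} I_{n-1} + Σ_{i=0}^{n-2} (-1)^{i+n-1} a_i I_n(i;n-1)`. -/
def LiL {R : Type*} [CommRing R] {n : ℕ} (M : Matrix (Fin (n+1)) (Fin (n+1)) R)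
    (hn : 1 ≤ n) : R :=
  borderCoeff M ⟨n-1, by omega⟩ * Iprev M
    + ∑ i : Fin (n-1), (-1 : R) ^ ((i : ℕ) + (n-1))
        * borderCoeff M (finCastPred i)
        * ((topSq M).submatrix (skipAt (finCastPred i)) (skipAt (⟨n-1, by omega⟩ : Fin n))).det

/-- `Li'_n := a_{n-1} I_{n-1} + Σ_{j=0}^{n-2} (-1)^{j+n-1} a_j I_n(n-1;j)`. -/
def LiR {R : Type*} [CommRing R] {n : ℕ} (M : Matrix (Fin (n+1)) (Fin (n+1)) R)
    (hn : 1 ≤ n) : R :=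
  borderCoeff M ⟨n-1, by omega⟩ * Iprev M
    + ∑ j : Fin (n-1), (-1 : R) ^ ((j : ℕ) + (n-1))
        * borderCoeff M (finCastPred j)
        * ((topSq M).submatrix (skipAt (⟨n-1, by omega⟩ : Fin n)) (skipAt (finCastPred j))).det

/-- If a symmetric matrix has determinant zero and its adjugate vanishes at `(l, l)`, then every
entry of the adjugate in column `l` squares to zero. -/
theorem Matrix.IsSymm.adjugate_mul_self_eq_zero {S ι : Type*} [CommRing S] [Fintype ι]
    [DecidableEq ι] {A : Matrix ι ι S} (hA : A.IsSymm) (hdet : A.det = 0) {l : ι}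
    (hl : A.adjugate l l = 0) (k : ι) : A.adjugate k l * A.adjugate k l = 0 := by
  set c : ι → S := fun i => A.adjugate i l with hc
  set B := A.updateRow l (Pi.single k 1) with hB
  have hcA : c ᵥ* A = 0 := by
    rw [← hA.eq, vecMul_transpose]
    ext i
    have h := congrFun (congrFun (mul_adjugate A) i) l
    rw [hdet, zero_smul] at h
    exact h
  have hcB : c ᵥ* B = 0 := by
    rw [← hcA]
    ext j
    refine Finset.sum_congr rfl fun i _ => ?_
    by_cases h : i = l
    · subst h
      simp [hc, hl]
    · simp [hB, updateRow_ne h]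
  have hBdet : B.det = c k := (adjugate_apply A k l).symm
  have h : c ᵥ* (B * B.adjugate) = 0 := by
    rw [← vecMul_vecMul, hcB, zero_vecMul]
  rw [mul_adjugate, hBdet, vecMul_smul, vecMul_one] at h
  exact congrFun h k

theorem skipAt_eq_succAbove {m : ℕ} (i : Fin (m + 1)) :
    (skipAt i : Fin m → Fin (m + 1)) = i.succAbove := by
  ext x
  simp only [skipAt, Fin.succAbove, Fin.lt_def, Fin.val_castSucc]
  split_ifs <;> rfl

theorem Iprev_eq_det_submatrix_last {R : Type*} [CommRing R] {m : ℕ}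
    (M : Matrix (Fin (m + 1 + 1)) (Fin (m + 1 + 1)) R) :
    Iprev M = ((topSq M).submatrix (Fin.last m).succAbove (Fin.last m).succAbove).det := by
  rw [Fin.succAbove_last]
  rfl

/-- For a symmetric matrix with `R/(I_n)` a domain and `I_{n-1} ≡ 0 (mod I_n)`,
each minor `I_n(i;n-1)` with `0 ≤ i ≤ n-2` lies in the ideal generated by `I_n`. -/
theorem minor_lastCol_mem_of_Iprev_mem {R : Type*} [CommRing R] {n : ℕ} (hn : 2 ≤ n)
    (M : Matrix (Fin (n+1)) (Fin (n+1)) R) (hsym : M.IsSymm)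
    (hdom : IsDomain (R ⧸ Ideal.span {(topSq M).det}))
    (hprev : Iprev M ∈ Ideal.span {(topSq M).det})
    (i : Fin (n-1)) :
    ((topSq M).submatrix (skipAt (finCastPred i)) (skipAt (⟨n-1, by omega⟩ : Fin n))).det
      ∈ Ideal.span {(topSq M).det} := by
  obtain ⟨m, rfl⟩ : ∃ m, n = m + 1 := ⟨n - 1, by omega⟩
  set A := topSq M
  have hA : A.IsSymm := hsym.submatrix Fin.castSucc
  set l : Fin (m + 1) := Fin.last m
  let q := Ideal.Quotient.mk (Ideal.span {A.det})
  have hAsymm : (q.mapMatrix A).IsSymm := hA.map q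
  have hdet : (q.mapMatrix A).det = 0 := by
    rw [← RingHom.map_det]
    exact Ideal.Quotient.eq_zero_iff_mem.2 (Ideal.mem_span_singleton_self _)
  have hadj (k : Fin (m + 1)) : (q.mapMatrix A).adjugate k l =
      (-1) ^ ((l : ℕ) + k) * q (A.submatrix l.succAbove k.succAbove).det := by
    rw [← RingHom.map_adjugate, RingHom.mapMatrix_apply, map_apply,
      adjugate_fin_succ_eq_det_submatrix]
    simp
  have hl : (q.mapMatrix A).adjugate l l = 0 := by
    rw [hadj, ← Iprev_eq_det_submatrix_last, Ideal.Quotient.eq_zero_iff_mem.2 hprev, mul_zero]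
  have hminor := mul_self_eq_zero.1 (hAsymm.adjugate_mul_self_eq_zero hdet hl (finCastPred i))
  rw [hadj, ((isUnit_one.neg).pow _).mul_right_eq_zero] at hminor
  have htr : (A.submatrix (finCastPred i).succAbove l.succAbove).det =
      (A.submatrix l.succAbove (finCastPred i).succAbove).det := by
    rw [← det_transpose, transpose_submatrix, hA.eq]
  have hmem := Ideal.Quotient.eq_zero_iff_mem.1 hminor
  rw [← htr, ← skipAt_eq_succAbove, ← skipAt_eq_succAbove] at hmem
  exact hmem
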